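/- Low×high improvement of the bilinear paraproduct estimate (Proposition 2.6(ii)). Let σ ∈ (0,1). Let α₁ < 0 < β₁ and γ₁ ∈ ℝ satisfy γ₁ ≤ α₁ + (1−σ)β₁ and α₁ + β₁ > 0, and let α₂, β₂ ∈ ℝ∖{0}, γ₂ ∈ ℝ satisfy γ₂ ≤ min(α₂, β₂) and α₂ + β₂ > 0. Then there is a constant C, depending only on σ and the exponents, such that for all C_b^∞ functions F, G: ℝ² → ℝ and every finite set S of pairs (M,N) of dyadic scales with M ≤ N^{1/(1−σ)}, one has ‖Σ_{(M,N)∈S} P_M^u F · P_N^u G‖_{C_u^{γ₁}C_v^{γ₂}} ≤ C‖F‖_{C_u^{α₁}C_v^{α₂}}‖G‖_{C_u^{β₁}C_v^{β₂}}. -/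

import Mathlib

noncomputable section

open Real MeasureTheory
open scoped ENNReal Classical NNReal

/-- A function between real normed spaces is `C_b^∞`: it is smooth and it together with all of
its iterated derivatives is bounded. -/
def CbSmooth {E F : Type*} [NormedAddCommGroup E] [NormedSpace ℝ E]
    [NormedAddCommGroup F] [NormedSpace ℝ F] (f : E → F) : Prop :=
  ContDiff ℝ (⊤ : ℕ∞) f ∧ ∀ n : ℕ, ∃ C : ℝ, ∀ x : E, ‖iteratedFDeriv ℝ n f x‖ ≤ C

/-- An admissible Littlewood–Paley cutoff: a smooth even `[0,1]`-valued function which is `≡ 1`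
on `{|ξ| ≤ 7/8}` and vanishes on `{|ξ| ≥ 9/8}`. -/
structure IsLPCutoff (ρ : ℝ → ℝ) : Prop where
  smooth : ContDiff ℝ (⊤ : ℕ∞) ρ
  nonneg : ∀ ξ, 0 ≤ ρ ξ
  le_one : ∀ ξ, ρ ξ ≤ 1
  even : ∀ ξ, ρ (-ξ) = ρ ξ
  eq_one : ∀ ξ : ℝ, |ξ| ≤ 7 / 8 → ρ ξ = 1
  eq_zero : ∀ ξ : ℝ, 9 / 8 ≤ |ξ| → ρ ξ = 0

/-- The Littlewood–Paley symbol `ρ_N` at the dyadic scale `N = 2 ^ k`. -/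
def lpSymbol (ρ : ℝ → ℝ) : ℕ → ℝ → ℝ
  | 0 => ρ
  | k + 1 => fun ξ => ρ (ξ / 2 ^ (k + 1)) - ρ (2 * ξ / 2 ^ (k + 1))

/-- The inverse Fourier transform `(2π)^{-1/2} ∫ e^{ixξ} g(ξ) dξ` of a real even function,
written as a cosine transform. -/
def invFourier (g : ℝ → ℝ) (x : ℝ) : ℝ :=
  (Real.sqrt (2 * Real.pi))⁻¹ * ∫ ξ : ℝ, Real.cos (x * ξ) * g ξ

/-- The Littlewood–Paley convolution kernel `ρ̌_N`, `N = 2 ^ k`. -/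
def lpKernel (ρ : ℝ → ℝ) (k : ℕ) : ℝ → ℝ :=
  invFourier (lpSymbol ρ k)

/-- The Littlewood–Paley projection `P_N f = ρ̌_N ∗ f`, `N = 2 ^ k`. -/
def LP (ρ : ℝ → ℝ) (k : ℕ) (f : ℝ → ℝ) (x : ℝ) : ℝ :=
  ∫ y : ℝ, lpKernel ρ k y * f (x - y)

/-- The Littlewood–Paley projection in the first variable. -/
def LPu (ρ : ℝ → ℝ) (k : ℕ) (F : ℝ × ℝ → ℝ) (p : ℝ × ℝ) : ℝ :=
  ∫ y : ℝ, lpKernel ρ k y * F (p.1 - y, p.2)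

/-- The Littlewood–Paley projection in the second variable. -/
def LPv (ρ : ℝ → ℝ) (k : ℕ) (F : ℝ × ℝ → ℝ) (p : ℝ × ℝ) : ℝ :=
  ∫ y : ℝ, lpKernel ρ k y * F (p.1, p.2 - y)

/-- The Hölder norm `‖f‖_{C^γ} = sup_N N^γ ‖P_N f‖_{L^∞}`, valued in `[0,∞]`. -/
def hNorm (ρ : ℝ → ℝ) (γ : ℝ) (f : ℝ → ℝ) : ℝ≥0∞ :=
  ⨆ k : ℕ, ENNReal.ofReal (((2 : ℝ) ^ k) ^ γ) * ⨆ x : ℝ, ENNReal.ofReal |LP ρ k f x|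

/-- The product Hölder norm `‖F‖_{C_u^{γ₁} C_v^{γ₂}}`, valued in `[0,∞]`. -/
def hNorm2 (ρ : ℝ → ℝ) (γ₁ γ₂ : ℝ) (F : ℝ × ℝ → ℝ) : ℝ≥0∞ :=
  ⨆ k₁ : ℕ, ⨆ k₂ : ℕ,
    ENNReal.ofReal (((2 : ℝ) ^ k₁) ^ γ₁ * ((2 : ℝ) ^ k₂) ^ γ₂) *
      ⨆ p : ℝ × ℝ, ENNReal.ofReal |LPu ρ k₁ (LPv ρ k₂ F) p|

/-- `2 ^ k₁ ∼ 2 ^ k₂`: comparable dyadic scales. -/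
def DClose (k₁ k₂ : ℕ) : Prop :=
  (2 : ℝ) ^ k₂ / 2 ^ 10 < (2 : ℝ) ^ k₁ ∧ (2 : ℝ) ^ k₁ < 2 ^ 10 * (2 : ℝ) ^ k₂

/-- `2 ^ k₁ ≪ 2 ^ k₂`. -/
def DLow (k₁ k₂ : ℕ) : Prop := (2 : ℝ) ^ k₁ ≤ (2 : ℝ) ^ k₂ / 2 ^ 10

/-- `2 ^ k₁ ≳ 2 ^ k₂`. -/
def DGtr (k₁ k₂ : ℕ) : Prop := (2 : ℝ) ^ k₂ ≤ 2 ^ 10 * (2 : ℝ) ^ k₁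

open scoped FourierTransform

structure GoodSym (g : ℝ → ℝ) : Prop where
  smooth : ContDiff ℝ (⊤ : ℕ∞) g
  cpt : HasCompactSupport g
  even : ∀ ξ, g (-ξ) = g ξ

lemma GoodSym.cont {g : ℝ → ℝ} (hg : GoodSym g) : Continuous g := hg.smooth.continuous

lemma GoodSym.integrable {g : ℝ → ℝ} (hg : GoodSym g) : Integrable g :=
  hg.cont.integrable_of_hasCompactSupport hg.cpt

lemma integrable_cexp_mul {h : ℝ → ℂ} (hh : Integrable h) (x : ℝ) :
    Integrable (fun ξ : ℝ => Complex.exp (((x * ξ : ℝ) : ℂ) * Complex.I) * h ξ) := by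
  refine hh.bdd_mul (c := 1) (Continuous.aestronglyMeasurable (by fun_prop)) ?_
  filter_upwards with ξ
  rw [Complex.norm_exp_ofReal_mul_I]

lemma invFourier_eq {g : ℝ → ℝ} (hg : GoodSym g) (x : ℝ) :
    (invFourier g x : ℂ) = ((Real.sqrt (2 * Real.pi))⁻¹ : ℝ) *
      ∫ ξ : ℝ, Complex.exp (((x * ξ : ℝ) : ℂ) * Complex.I) * (g ξ : ℂ) := by
  have hgc : Integrable (fun ξ => (g ξ : ℂ)) := hg.integrable.ofReal
  have h1 : ∫ ξ : ℝ, Complex.exp (((x * ξ : ℝ) : ℂ) * Complex.I) * (g ξ : ℂ)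
      = ∫ ξ : ℝ, Complex.exp ((((-x) * ξ : ℝ) : ℂ) * Complex.I) * (g ξ : ℂ) := by
    rw [← integral_neg_eq_self]
    congr 1
    ext ξ
    rw [hg.even]
    simp
  have h2 : ∫ ξ : ℝ, Complex.exp (((x * ξ : ℝ) : ℂ) * Complex.I) * (g ξ : ℂ)
      = ∫ ξ : ℝ, ((Real.cos (x * ξ) * g ξ : ℝ) : ℂ) := by
    have h3 : (2:ℂ) * ∫ ξ : ℝ, Complex.exp (((x * ξ : ℝ) : ℂ) * Complex.I) * (g ξ : ℂ)
      = 2 * ∫ ξ : ℝ, ((Real.cos (x * ξ) * g ξ : ℝ) : ℂ) := by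
      rw [two_mul]
      nth_rewrite 2 [h1]
      rw [← integral_add (integrable_cexp_mul hgc x) (integrable_cexp_mul hgc (-x)),
        ← integral_const_mul]
      congr 1
      ext ξ
      push_cast
      rw [Complex.cos]
      ring_nf
    exact mul_left_cancel₀ two_ne_zero h3
  rw [h2, invFourier, integral_complex_ofReal]
  push_cast
  rfl

lemma invFourier_eq_fourier {g : ℝ → ℝ} (hg : GoodSym g) (x : ℝ) :
    (invFourier g x : ℂ) = ((Real.sqrt (2 * Real.pi))⁻¹ : ℝ) *
      𝓕 (fun ξ => (g ξ : ℂ)) (x / (-(2 * Real.pi))) := by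
  rw [invFourier_eq hg, Real.fourier_real_eq_integral_exp_smul]
  congr 2
  ext ξ
  rw [smul_eq_mul]
  congr 3
  have := Real.pi_pos.ne'
  push_cast
  field_simp

def GoodSym.sch {g : ℝ → ℝ} (hg : GoodSym g) : SchwartzMap ℝ ℂ :=
  HasCompactSupport.toSchwartzMap (f := fun ξ => (g ξ : ℂ))
    (hg.cpt.comp_left (g := fun x : ℝ => (x : ℂ)) (by simp))
    (Complex.ofRealCLM.contDiff.comp hg.smooth)

lemma GoodSym.sch_coe {g : ℝ → ℝ} (hg : GoodSym g) : (hg.sch : ℝ → ℂ) = fun ξ => (g ξ : ℂ) := rfl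

lemma invFourier_eq_sch {g : ℝ → ℝ} (hg : GoodSym g) :
    (fun x => (invFourier g x : ℂ)) = fun x => (((Real.sqrt (2 * Real.pi))⁻¹ : ℝ) : ℂ) *
      (𝓕 hg.sch) (x / (-(2 * Real.pi))) := by
  ext x
  rw [invFourier_eq_fourier hg, SchwartzMap.fourier_coe, hg.sch_coe]

lemma invFourier_cont {g : ℝ → ℝ} (hg : GoodSym g) : Continuous (invFourier g) := by
  have h : Continuous (fun x => (invFourier g x : ℂ)) := by
    rw [invFourier_eq_sch hg]
    have := (𝓕 hg.sch).continuous
    fun_prop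
  have := Complex.continuous_re.comp h
  simpa [Function.comp_def] using this

lemma invFourier_integrable {g : ℝ → ℝ} (hg : GoodSym g) : Integrable (invFourier g) := by
  have h : Integrable (fun x => (invFourier g x : ℂ)) := by
    rw [invFourier_eq_sch hg]
    refine Integrable.const_mul ?_ _
    exact ((𝓕 hg.sch).integrable (μ := volume)).comp_div (by simp [Real.pi_pos.ne'])
  have := h.re
  simpa using this

lemma inversion {g : ℝ → ℝ} (hg : GoodSym g) (ζ : ℝ) :
    ∫ y : ℝ, Complex.exp (((ζ * y : ℝ) : ℂ) * Complex.I) * (invFourier g y : ℂ)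
      = (Real.sqrt (2 * Real.pi) : ℝ) * (g ζ : ℂ) := by
  have hpi := Real.pi_pos
  have h0 : 𝓕⁻ (𝓕 (fun ξ => (g ξ : ℂ))) = (fun ξ => (g ξ : ℂ)) := by
    have := hg.sch.continuous.fourierInv_fourier_eq hg.sch.integrable
      (by rw [← SchwartzMap.fourier_coe]; exact (𝓕 hg.sch).integrable)
    exact this
  have h1 := congrFun h0 (-ζ)
  rw [Real.fourierInv_eq'] at h1
  simp only [hg.even] at h1
  have h2 := Measure.integral_comp_div (fun w : ℝ => Complex.exp (↑(2 * π * inner ℝ w (-ζ)) * Complex.I) • 𝓕 (fun ξ => (g ξ : ℂ)) w) (-(2 * Real.pi))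
  rw [h1] at h2
  have h3 : ∀ y : ℝ, Complex.exp (((ζ * y : ℝ) : ℂ) * Complex.I) * (invFourier g y : ℂ) =
    ((Real.sqrt (2 * Real.pi))⁻¹ : ℝ) * (Complex.exp (↑(2 * π * inner ℝ (y / (-(2 * Real.pi))) (-ζ)) * Complex.I) • 𝓕 (fun ξ => (g ξ : ℂ)) (y / (-(2 * Real.pi)))) := by
    intro y
    rw [invFourier_eq_fourier hg, smul_eq_mul]
    have : (2 * π * inner ℝ (y / (-(2 * Real.pi))) (-ζ)) = ζ * y := by
      simp only [inner, starRingEnd_apply, star_trivial, RCLike.re_to_real]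
      field_simp
    rw [this]
    ring
  simp_rw [h3]
  rw [integral_const_mul, h2, abs_neg, abs_of_pos (by positivity), Complex.real_smul, ← mul_assoc, ← Complex.ofReal_mul]
  congr 2
  have : 0 < √(2 * π) := by positivity
  field_simp
  rw [Real.sq_sqrt (by positivity)]

lemma parseval {g : ℝ → ℝ} (hg : GoodSym g) {h : ℝ → ℂ} (hh : Integrable h) :
    ∫ y : ℝ, (invFourier g y : ℂ) * h y = ((Real.sqrt (2 * Real.pi))⁻¹ : ℝ) *
      ∫ ξ : ℝ, (g ξ : ℂ) * ∫ y : ℝ, Complex.exp (((ξ * y : ℝ) : ℂ) * Complex.I) * h y := by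
  simp_rw [invFourier_eq hg, mul_assoc]
  rw [integral_const_mul]
  congr 1
  simp_rw [← integral_mul_const, ← integral_const_mul]
  rw [integral_integral_swap]
  · congr 1; ext ξ; congr 1; ext y
    rw [mul_comm y ξ]; ring
  · have h1 : Integrable (fun p : ℝ × ℝ => h p.1 * (g p.2 : ℂ)) (volume.prod volume) :=
      hh.mul_prod hg.integrable.ofReal
    have := h1.bdd_mul (c := 1) (f := fun p : ℝ × ℝ => Complex.exp (((p.1 * p.2 : ℝ) : ℂ) * Complex.I))
      (Continuous.aestronglyMeasurable (by fun_prop)) (by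
        filter_upwards with ξ
        rw [Complex.norm_exp_ofReal_mul_I])
    refine this.congr ?_
    filter_upwards with p
    simp [Function.uncurry]
    ring

lemma invFourier_bdd {g : ℝ → ℝ} (hg : GoodSym g) : ∃ C, ∀ x, |invFourier g x| ≤ C := by
  refine ⟨(Real.sqrt (2 * Real.pi))⁻¹ * ∫ ξ, |g ξ|, fun x => ?_⟩
  rw [invFourier, abs_mul, abs_of_nonneg (by positivity)]
  gcongr
  refine (abs_integral_le_integral_abs).trans ?_
  refine integral_mono_of_nonneg (by filter_upwards with a; positivity) hg.integrable.abs ?_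
  filter_upwards with ξ
  rw [abs_mul]
  exact mul_le_of_le_one_left (abs_nonneg _) (Real.abs_cos_le_one _)

/-- the trilinear kernel vanishes for incompatible frequency supports -/
lemma tri_zero {g₀ g₁ g₂ : ℝ → ℝ} (h₀ : GoodSym g₀) (h₁ : GoodSym g₁) (h₂ : GoodSym g₂)
    (hv : ∀ ξ η : ℝ, g₀ ξ * g₁ η * g₂ (ξ - η) = 0) (a b : ℝ) :
    ∫ y : ℝ, invFourier g₀ y * (invFourier g₁ (a - y) * invFourier g₂ (b - y)) = 0 := by
  obtain ⟨C, hC⟩ := invFourier_bdd h₁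
  have i2 : Integrable (fun y => invFourier g₂ (b - y)) := (invFourier_integrable h₂).comp_sub_left b
  have i3 : Integrable (fun y => invFourier g₁ (a - y) * invFourier g₂ (b - y)) :=
    i2.bdd_mul (c := C) (((invFourier_cont h₁).comp (continuous_const.sub continuous_id)).aestronglyMeasurable)
      (by filter_upwards with y using hC _)
  have e : ((∫ y : ℝ, invFourier g₀ y * (invFourier g₁ (a - y) * invFourier g₂ (b - y)) : ℝ) : ℂ) = 0 := by
    rw [← integral_complex_ofReal]
    simp_rw [Complex.ofReal_mul (invFourier g₀ _)]
    have i4 : Integrable (fun y => ((invFourier g₁ (a - y) * invFourier g₂ (b - y) : ℝ) : ℂ)) := i3.ofReal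
    rw [parseval h₀ i4]
    refine mul_eq_zero_of_right _ ?_
    refine integral_eq_zero_of_ae ?_
    filter_upwards with ξ
    rw [Pi.zero_apply]
    by_cases hξ : g₀ ξ = 0
    · simp [hξ]
    refine mul_eq_zero_of_right _ ?_
    rw [← integral_sub_left_eq_self _ _ a]
    simp only [sub_sub_cancel]
    have : ∀ x : ℝ, Complex.exp (((ξ * (a - x) : ℝ) : ℂ) * Complex.I) *
        ((invFourier g₁ x * invFourier g₂ (b - (a - x)) : ℝ) : ℂ) =
        (invFourier g₁ x : ℂ) * (Complex.exp (((ξ * (a - x) : ℝ) : ℂ) * Complex.I) *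
         (invFourier g₂ (b - (a - x)) : ℂ)) := by
      intro x; push_cast; ring
    simp_rw [this]
    rw [parseval h₁]
    · refine mul_eq_zero_of_right _ ?_
      refine integral_eq_zero_of_ae ?_
      filter_upwards with η
      rw [Pi.zero_apply]
      by_cases hη : g₁ η = 0
      · simp [hη]
      have hz : g₂ (ξ - η) = 0 := by
        have := hv ξ η
        simpa [hξ, hη] using this
      refine mul_eq_zero_of_right _ ?_
      rw [← integral_sub_right_eq_self _ (b - a)]
      have : ∀ x : ℝ, Complex.exp (((η * (x - (b - a)) : ℝ) : ℂ) * Complex.I) *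
        (Complex.exp (((ξ * (a - (x - (b - a))) : ℝ) : ℂ) * Complex.I) *
         (invFourier g₂ (b - (a - (x - (b - a)))) : ℂ)) =
         Complex.exp (((ξ * b - η * (b - a) : ℝ) : ℂ) * Complex.I) *
         (Complex.exp ((((η - ξ) * x : ℝ) : ℂ) * Complex.I) * (invFourier g₂ x : ℂ)) := by
        intro x
        rw [← mul_assoc, ← mul_assoc, ← Complex.exp_add, ← Complex.exp_add]
        congr 2
        · push_cast; ring_nf
        · ring_nf
      simp_rw [this]
      rw [integral_const_mul, inversion h₂]
      have : g₂ (η - ξ) = 0 := by rw [← h₂.even, neg_sub, hz]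
      simp [this]
    · refine Integrable.bdd_mul (c := 1) ?_ (Continuous.aestronglyMeasurable (by fun_prop)) ?_
      · have : Integrable (fun x => invFourier g₂ (x + (b - a))) := (invFourier_integrable h₂).comp_add_right (b - a)
        refine this.ofReal.congr ?_
        filter_upwards with x
        congr 2; ring
      · filter_upwards with x
        rw [Complex.norm_exp_ofReal_mul_I]
  exact_mod_cast e

lemma GoodSym.scale {g : ℝ → ℝ} (hg : GoodSym g) {c : ℝ} (hc : 0 < c) :
    GoodSym (fun ξ => g (ξ / c)) where
  smooth := hg.smooth.comp (contDiff_id.div_const c)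
  cpt := by
    have := hg.cpt.comp_homeomorph (Homeomorph.mulRight₀ c⁻¹ (inv_ne_zero hc.ne'))
    simpa [Function.comp_def, div_eq_mul_inv] using this
  even := fun ξ => by rw [neg_div, hg.even]

lemma GoodSym.sub {g h : ℝ → ℝ} (hg : GoodSym g) (hh : GoodSym h) :
    GoodSym (fun ξ => g ξ - h ξ) where
  smooth := hg.smooth.sub hh.smooth
  cpt := by
    have := hg.cpt.add (hh.cpt.comp_left (g := fun x : ℝ => -x) (by simp))
    have e : (fun ξ => g ξ - h ξ) = g + (fun x => -x) ∘ h := by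
      ext ξ; simp [sub_eq_add_neg]
    rw [e]; exact this
  even := fun ξ => by rw [hg.even, hh.even]

lemma IsLPCutoff.good {ρ : ℝ → ℝ} (hρ : IsLPCutoff ρ) : GoodSym ρ where
  smooth := hρ.smooth
  even := hρ.even
  cpt := by
    refine HasCompactSupport.intro (K := Set.Icc (-(9/8)) (9/8)) isCompact_Icc ?_
    intro x hx
    apply hρ.eq_zero
    by_contra h
    push Not at h
    exact hx ⟨by linarith [(abs_lt.1 h).1], by linarith [(abs_lt.1 h).2]⟩

lemma lpSymbol_succ (ρ : ℝ → ℝ) (k : ℕ) :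
    lpSymbol ρ (k + 1) = fun ξ => ρ (ξ / 2 ^ (k + 1)) - ρ (ξ / 2 ^ k) := by
  ext ξ
  simp only [lpSymbol]
  congr 2
  rw [pow_succ]; field_simp

lemma lpSymbol_good {ρ : ℝ → ℝ} (hρ : IsLPCutoff ρ) (k : ℕ) : GoodSym (lpSymbol ρ k) := by
  cases k with
  | zero => exact hρ.good
  | succ k =>
    rw [lpSymbol_succ]
    exact (hρ.good.scale (by positivity)).sub (hρ.good.scale (by positivity))

lemma lpSymbol_supp {ρ : ℝ → ℝ} (hρ : IsLPCutoff ρ) (k : ℕ) (ξ : ℝ) (h : lpSymbol ρ k ξ ≠ 0) :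
    |ξ| ≤ 9 / 8 * 2 ^ k ∧ (k ≠ 0 → 7 / 16 * 2 ^ k ≤ |ξ|) := by
  cases k with
  | zero =>
    refine ⟨?_, fun h => absurd rfl h⟩
    by_contra hc
    push Not at hc
    exact h (hρ.eq_zero _ (by simp at hc; linarith))
  | succ k =>
    rw [lpSymbol_succ] at h
    have hp : (0:ℝ) < 2 ^ k := by positivity
    have hp1 : (2:ℝ) ^ (k+1) = 2 * 2 ^ k := by ring
    have a1 : |ξ / 2 ^ k| = |ξ| / 2 ^ k := by rw [abs_div, abs_of_pos hp]
    have a2 : |ξ / 2 ^ (k+1)| = |ξ| / (2 * 2 ^ k) := by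
      rw [abs_div, hp1, abs_of_pos (show (0:ℝ) < 2 * 2 ^ k by positivity)]
    constructor
    · by_contra hc
      push Not at hc
      rw [hp1] at hc
      apply h
      dsimp only
      rw [hρ.eq_zero, hρ.eq_zero, sub_zero]
      · rw [a1, le_div_iff₀ hp]; nlinarith
      · rw [a2, le_div_iff₀ (by positivity)]; nlinarith
    · intro _
      by_contra hc
      push Not at hc
      rw [hp1] at hc
      apply h
      dsimp only
      rw [hρ.eq_one, hρ.eq_one, sub_self]
      · rw [a1, div_le_iff₀ hp]; nlinarith
      · rw [a2, div_le_iff₀ (by positivity)]; nlinarith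

def Compat (K M N : ℕ) : Prop := K ≤ max M N + 2 ∧ M ≤ max K N + 2 ∧ N ≤ max K M + 2

lemma top_aux {A B C : ℕ} {x y z : ℝ} (hA : A ≠ 0 → 7 / 16 * 2 ^ A ≤ |x|)
    (hB : |y| ≤ 9 / 8 * 2 ^ B) (hC : |z| ≤ 9 / 8 * 2 ^ C) (hx : |x| ≤ |y| + |z|) :
    A ≤ max B C + 2 := by
  by_contra hc
  push Not at hc
  have h1 := hA (by omega)
  have h2 : (2:ℝ) ^ (max B C + 3) ≤ 2 ^ A := pow_le_pow_right₀ (by norm_num) (by omega)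
  have h3 : (2:ℝ) ^ B ≤ 2 ^ (max B C) := pow_le_pow_right₀ (by norm_num) (by omega)
  have h4 : (2:ℝ) ^ C ≤ 2 ^ (max B C) := pow_le_pow_right₀ (by norm_num) (by omega)
  have h5 : (0:ℝ) < 2 ^ (max B C) := by positivity
  rw [pow_add] at h2
  linarith

lemma compat_of {ρ : ℝ → ℝ} (hρ : IsLPCutoff ρ) {K M N : ℕ} (h : ¬ Compat K M N) (ξ η : ℝ) :
    lpSymbol ρ K ξ * lpSymbol ρ M η * lpSymbol ρ N (ξ - η) = 0 := by
  by_contra hne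
  apply h
  have h1 := lpSymbol_supp hρ K ξ (fun h => hne (by simp [h]))
  have h2 := lpSymbol_supp hρ M η (fun h => hne (by simp [h]))
  have h3 := lpSymbol_supp hρ N (ξ - η) (fun h => hne (by simp [h]))
  refine ⟨top_aux h1.2 h2.1 h3.1 ?_, top_aux h2.2 h1.1 h3.1 ?_, top_aux h3.2 h1.1 h2.1 ?_⟩
  · have := abs_add_le η (ξ - η); simpa using this
  · have := abs_sub ξ (ξ - η); simpa using this
  · exact abs_sub _ _

lemma invFourier_scale (g : ℝ → ℝ) {c : ℝ} (hc : 0 < c) (x : ℝ) :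
    invFourier (fun ξ => g (ξ / c)) x = c * invFourier g (c * x) := by
  unfold invFourier
  have := Measure.integral_comp_div (fun ξ => Real.cos (c * x * ξ) * g ξ) c
  rw [abs_of_pos hc, smul_eq_mul] at this
  rw [mul_left_comm, ← this]
  congr 2
  ext ξ
  congr 2
  field_simp

lemma integrable_cos_mul {g : ℝ → ℝ} (hg : GoodSym g) (x : ℝ) :
    Integrable (fun ξ => Real.cos (x * ξ) * g ξ) :=
  hg.integrable.bdd_mul (c := 1) (Continuous.aestronglyMeasurable (by fun_prop))
    (by filter_upwards with ξ using Real.abs_cos_le_one _)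

lemma invFourier_sub {g h : ℝ → ℝ} (hg : GoodSym g) (hh : GoodSym h) (x : ℝ) :
    invFourier (fun ξ => g ξ - h ξ) x = invFourier g x - invFourier h x := by
  unfold invFourier
  rw [← mul_sub, ← integral_sub (integrable_cos_mul hg x) (integrable_cos_mul hh x)]
  simp_rw [mul_sub]

lemma lpKernel_succ {ρ : ℝ → ℝ} (hρ : IsLPCutoff ρ) (k : ℕ) (x : ℝ) :
    lpKernel ρ (k + 1) x =
      2 ^ (k + 1) * lpKernel ρ 0 (2 ^ (k + 1) * x) - 2 ^ k * lpKernel ρ 0 (2 ^ k * x) := by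
  unfold lpKernel
  rw [lpSymbol_succ, invFourier_sub (hρ.good.scale (by positivity)) (hρ.good.scale (by positivity)),
    invFourier_scale ρ (by positivity), invFourier_scale ρ (by positivity)]
  rfl

lemma lpKernel_sum {ρ : ℝ → ℝ} (hρ : IsLPCutoff ρ) (L : ℕ) (x : ℝ) :
    ∑ k ∈ Finset.range (L + 1), lpKernel ρ k x = 2 ^ L * lpKernel ρ 0 (2 ^ L * x) := by
  induction L with
  | zero => simp
  | succ L ih => rw [Finset.sum_range_succ, ih, lpKernel_succ hρ]; ring

lemma lpKernel_cont {ρ : ℝ → ℝ} (hρ : IsLPCutoff ρ) (k : ℕ) : Continuous (lpKernel ρ k) :=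
  invFourier_cont (lpSymbol_good hρ k)

lemma lpKernel_int {ρ : ℝ → ℝ} (hρ : IsLPCutoff ρ) (k : ℕ) : Integrable (lpKernel ρ k) :=
  invFourier_integrable (lpSymbol_good hρ k)

lemma integral_abs_scale (f : ℝ → ℝ) {c : ℝ} (hc : 0 < c) :
    ∫ x, |c * f (c * x)| = ∫ x, |f x| := by
  simp_rw [abs_mul, abs_of_pos hc]
  rw [integral_const_mul, Measure.integral_comp_mul_left (fun x => |f x|), abs_of_pos (by positivity), smul_eq_mul]
  field_simp

lemma lpKernel_L1 {ρ : ℝ → ℝ} (hρ : IsLPCutoff ρ) :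
    ∃ C : ℝ, 0 < C ∧ ∀ k, ∫ x, |lpKernel ρ k x| ≤ C := by
  refine ⟨2 * (∫ x, |lpKernel ρ 0 x|) + 1, by positivity, fun k => ?_⟩
  have h0 : 0 ≤ ∫ x, |lpKernel ρ 0 x| := by positivity
  cases k with
  | zero => linarith
  | succ k =>
    have i : ∀ c : ℝ, 0 < c → Integrable (fun x => |c * lpKernel ρ 0 (c * x)|) := fun c hc =>
      (((lpKernel_int hρ 0).comp_mul_left' hc.ne').const_mul c).abs
    have : ∫ x, |lpKernel ρ (k+1) x| ≤ ∫ x, (|2 ^ (k + 1) * lpKernel ρ 0 (2 ^ (k + 1) * x)| + |2 ^ k * lpKernel ρ 0 (2 ^ k * x)|) := by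
      refine integral_mono (lpKernel_int hρ _).abs ((i _ (by positivity)).add (i _ (by positivity))) ?_
      intro x
      dsimp only
      rw [lpKernel_succ hρ]
      exact abs_sub _ _
    rw [integral_add (i _ (by positivity)) (i _ (by positivity)), integral_abs_scale _ (by positivity), integral_abs_scale _ (by positivity)] at this
    linarith

lemma lpKernel_zero_integral {ρ : ℝ → ℝ} (hρ : IsLPCutoff ρ) :
    ∫ x, lpKernel ρ 0 x = Real.sqrt (2 * Real.pi) := by
  have := inversion hρ.good 0
  rw [hρ.eq_one 0 (by norm_num)] at this
  simp only [zero_mul, Complex.ofReal_zero, Complex.exp_zero, one_mul, Complex.ofReal_one, mul_one] at this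
  rw [integral_complex_ofReal] at this
  exact_mod_cast this
open Filter Topology

/-- bounded continuous functions of two variables with explicit bound -/
structure BC (C : ℝ) (F : ℝ × ℝ → ℝ) : Prop where
  cont : Continuous F
  bdd : ∀ p, |F p| ≤ C

structure Ker (φ : ℝ → ℝ) : Prop where
  cont : Continuous φ
  int : Integrable φ

def cu (φ : ℝ → ℝ) (F : ℝ × ℝ → ℝ) (p : ℝ × ℝ) : ℝ := ∫ y : ℝ, φ y * F (p.1 - y, p.2)
def cv (φ : ℝ → ℝ) (F : ℝ × ℝ → ℝ) (p : ℝ × ℝ) : ℝ := ∫ y : ℝ, φ y * F (p.1, p.2 - y)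

lemma LPu_eq (ρ : ℝ → ℝ) (k : ℕ) (F : ℝ × ℝ → ℝ) : LPu ρ k F = cu (lpKernel ρ k) F := rfl
lemma LPv_eq (ρ : ℝ → ℝ) (k : ℕ) (F : ℝ × ℝ → ℝ) : LPv ρ k F = cv (lpKernel ρ k) F := rfl

lemma cv_swap (φ : ℝ → ℝ) (F : ℝ × ℝ → ℝ) (p : ℝ × ℝ) :
    cv φ F p = cu φ (F ∘ Prod.swap) p.swap := rfl

lemma BC.swap {C : ℝ} {F : ℝ × ℝ → ℝ} (h : BC C F) : BC C (F ∘ Prod.swap) :=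
  ⟨h.cont.comp continuous_swap, fun p => h.bdd _⟩

lemma cu_integrable {φ : ℝ → ℝ} (hφ : Ker φ) {C : ℝ} {F : ℝ × ℝ → ℝ} (h : BC C F) (p : ℝ × ℝ) :
    Integrable (fun y => φ y * F (p.1 - y, p.2)) := by
  refine hφ.int.mul_bdd (c := C) ?_ ?_
  · have := h.cont
    exact Continuous.aestronglyMeasurable (by fun_prop)
  · filter_upwards with y using h.bdd _

lemma cv_integrable {φ : ℝ → ℝ} (hφ : Ker φ) {C : ℝ} {F : ℝ × ℝ → ℝ} (h : BC C F) (p : ℝ × ℝ) :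
    Integrable (fun y => φ y * F (p.1, p.2 - y)) := cu_integrable hφ h.swap p.swap

/-- dominated convergence -/
lemma cu_tendsto {φ : ℝ → ℝ} (hφ : Ker φ) {C : ℝ} {Fn : ℕ → ℝ × ℝ → ℝ} {F : ℝ × ℝ → ℝ}
    (h : ∀ n, BC C (Fn n)) (hl : ∀ p, Tendsto (fun n => Fn n p) atTop (𝓝 (F p))) (p : ℝ × ℝ) :
    Tendsto (fun n => cu φ (Fn n) p) atTop (𝓝 (cu φ F p)) := by
  unfold cu
  refine tendsto_integral_of_dominated_convergence (fun y => |φ y| * C) ?_ ?_ ?_ ?_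
  · intro n
    exact (cu_integrable hφ (h n) p).1
  · exact hφ.int.abs.mul_const C
  · intro n
    filter_upwards with y
    rw [Real.norm_eq_abs, abs_mul]
    gcongr
    exact (h n).bdd _
  · filter_upwards with y
    exact (hl _).const_mul _

lemma cv_tendsto {φ : ℝ → ℝ} (hφ : Ker φ) {C : ℝ} {Fn : ℕ → ℝ × ℝ → ℝ} {F : ℝ × ℝ → ℝ}
    (h : ∀ n, BC C (Fn n)) (hl : ∀ p, Tendsto (fun n => Fn n p) atTop (𝓝 (F p))) (p : ℝ × ℝ) :
    Tendsto (fun n => cv φ (Fn n) p) atTop (𝓝 (cv φ F p)) :=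
  cu_tendsto (Fn := fun n => Fn n ∘ Prod.swap) hφ (fun n => (h n).swap) (fun p => hl p.swap) p.swap

lemma cu_bdd {φ : ℝ → ℝ} (hφ : Ker φ) {C : ℝ} {F : ℝ × ℝ → ℝ} (h : ∀ p, |F p| ≤ C) (p : ℝ × ℝ) :
    |cu φ F p| ≤ (∫ y, |φ y|) * C := by
  unfold cu
  refine abs_integral_le_integral_abs.trans ?_
  rw [← integral_mul_const]
  refine integral_mono_of_nonneg (by filter_upwards with a; positivity) (hφ.int.abs.mul_const C) ?_
  filter_upwards with y
  rw [abs_mul]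
  gcongr
  exact h _

lemma cv_bdd {φ : ℝ → ℝ} (hφ : Ker φ) {C : ℝ} {F : ℝ × ℝ → ℝ} (h : ∀ p, |F p| ≤ C) (p : ℝ × ℝ) :
    |cv φ F p| ≤ (∫ y, |φ y|) * C := cu_bdd (F := F ∘ Prod.swap) hφ (fun p => h _) p.swap

lemma BC.cu {φ : ℝ → ℝ} (hφ : Ker φ) {C : ℝ} {F : ℝ × ℝ → ℝ} (h : BC C F) :
    BC ((∫ y, |φ y|) * C) (cu φ F) := by
  refine ⟨?_, cu_bdd hφ h.bdd⟩
  unfold _root_.cu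
  refine continuous_of_dominated (bound := fun y => |φ y| * C) ?_ ?_ (hφ.int.abs.mul_const C) ?_
  · intro p; exact (cu_integrable hφ h p).1
  · intro p
    filter_upwards with y
    rw [Real.norm_eq_abs, abs_mul]
    gcongr
    exact h.bdd _
  · filter_upwards with y
    have := h.cont
    fun_prop

lemma BC.cv {φ : ℝ → ℝ} (hφ : Ker φ) {C : ℝ} {F : ℝ × ℝ → ℝ} (h : BC C F) :
    BC ((∫ y, |φ y|) * C) (cv φ F) := (h.swap.cu hφ).swap

lemma cu_cv_comm {φ ψ : ℝ → ℝ} (hφ : Ker φ) (hψ : Ker ψ) {C : ℝ} {F : ℝ × ℝ → ℝ} (h : BC C F) :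
    cu φ (cv ψ F) = cv ψ (cu φ F) := by
  ext p
  unfold cu cv
  simp_rw [← integral_const_mul]
  rw [integral_integral_swap]
  · congr 1; ext y; congr 1; ext z; ring
  · have h1 : Integrable (fun q : ℝ × ℝ => φ q.1 * ψ q.2) (volume.prod volume) :=
      hφ.int.mul_prod hψ.int
    have := h1.mul_bdd (c := C) (g := fun q : ℝ × ℝ => F (p.1 - q.1, p.2 - q.2))
      (by have := h.cont; exact Continuous.aestronglyMeasurable (by fun_prop))
      (by filter_upwards with q using h.bdd _)
    refine this.congr ?_
    filter_upwards with q
    simp [Function.uncurry]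
    ring

lemma BC.mul {A B : ℝ} {F G : ℝ × ℝ → ℝ} (hF : BC A F) (hG : BC B G) :
    BC (A * B) (fun p => F p * G p) := by
  refine ⟨hF.cont.mul hG.cont, fun p => ?_⟩
  rw [abs_mul]
  have := (abs_nonneg _).trans (hF.bdd p)
  gcongr
  exacts [hF.bdd p, hG.bdd p]

lemma BC.sum {ι : Type*} (S : Finset ι) {A : ι → ℝ} {F : ι → ℝ × ℝ → ℝ} (h : ∀ i ∈ S, BC (A i) (F i)) :
    BC (∑ i ∈ S, A i) (fun p => ∑ i ∈ S, F i p) := by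
  refine ⟨continuous_finsetSum _ fun i hi => (h i hi).cont, fun p => ?_⟩
  exact (Finset.abs_sum_le_sum_abs _ _).trans (Finset.sum_le_sum fun i hi => (h i hi).bdd p)

lemma cu_sum {φ : ℝ → ℝ} (hφ : Ker φ) {ι : Type*} (S : Finset ι) {A : ι → ℝ} {F : ι → ℝ × ℝ → ℝ}
    (h : ∀ i ∈ S, BC (A i) (F i)) :
    cu φ (fun p => ∑ i ∈ S, F i p) = fun p => ∑ i ∈ S, cu φ (F i) p := by
  ext p
  unfold cu
  rw [← integral_finsetSum _ (fun i hi => cu_integrable hφ (h i hi) p)]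
  simp_rw [Finset.mul_sum]

lemma cv_sum {φ : ℝ → ℝ} (hφ : Ker φ) {ι : Type*} (S : Finset ι) {A : ι → ℝ} {F : ι → ℝ × ℝ → ℝ}
    (h : ∀ i ∈ S, BC (A i) (F i)) :
    cv φ (fun p => ∑ i ∈ S, F i p) = fun p => ∑ i ∈ S, cv φ (F i) p := by
  ext p
  exact congrFun (cu_sum (F := fun i => F i ∘ Prod.swap) hφ S (fun i hi => (h i hi).swap)) p.swap

lemma cu_zero (φ : ℝ → ℝ) : cu φ (fun _ => 0) = fun _ => 0 := by ext p; simp [cu]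
lemma cv_zero (φ : ℝ → ℝ) : cv φ (fun _ => 0) = fun _ => 0 := by ext p; simp [cv]

lemma lpKer {ρ : ℝ → ℝ} (hρ : IsLPCutoff ρ) (k : ℕ) : Ker (lpKernel ρ k) :=
  ⟨lpKernel_cont hρ k, lpKernel_int hρ k⟩

lemma swap_int {h k f : ℝ → ℝ} (hh : Integrable h) (hk : Integrable k)
    (hf : Continuous f) {C : ℝ} (hC : ∀ x, |f x| ≤ C) :
    ∫ y, h y * ∫ a, k (a - y) * f a = ∫ a, f a * ∫ y, h y * k (a - y) := by
  simp_rw [← integral_const_mul]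
  rw [integral_integral_swap]
  · congr 1; ext y; congr 1; ext z; ring
  · have h1 : Integrable (fun q : ℝ × ℝ => h q.2 * k (q.1 - q.2)) (volume.prod volume) :=
      hh.convolution_integrand (ContinuousLinearMap.mul ℝ ℝ) hk
    have := h1.swap.mul_bdd (c := C) (g := fun q : ℝ × ℝ => f q.2)
      (Continuous.aestronglyMeasurable (by fun_prop))
      (by filter_upwards with q using hC _)
    refine this.congr ?_
    filter_upwards with q
    simp [Function.uncurry]
    ring

lemma vanish_u {ρ : ℝ → ℝ} (hρ : IsLPCutoff ρ) {K M N : ℕ} (hc : ¬ Compat K M N) {A B : ℝ}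
    {F G : ℝ × ℝ → ℝ} (hF : BC A F) (hG : BC B G) :
    cu (lpKernel ρ K) (fun p => cu (lpKernel ρ M) F p * cu (lpKernel ρ N) G p) = fun _ => 0 := by
  ext p
  obtain ⟨x, v⟩ := p
  have key : ∀ (k : ℕ) (H : ℝ × ℝ → ℝ) (y : ℝ), cu (lpKernel ρ k) H (x - y, v) =
      ∫ a, lpKernel ρ k (a - y) * H (x - a, v) := by
    intro k H y
    unfold cu
    rw [← integral_sub_right_eq_self _ y]
    congr 1; ext a
    congr 3; ring
  have bG := hG.cu (lpKer hρ N)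
  have cF := hF.cont
  have cG := hG.cont
  have i1 : Integrable (fun y => lpKernel ρ K y * cu (lpKernel ρ N) G (x - y, v)) :=
    cu_integrable (lpKer hρ K) bG (x, v)
  have e1 := swap_int (f := fun a => F (x - a, v)) i1 (lpKernel_int hρ M) (by fun_prop)
    (fun a => hF.bdd _)
  have e0 : cu (lpKernel ρ K) (fun p => cu (lpKernel ρ M) F p * cu (lpKernel ρ N) G p) (x, v) =
    ∫ y, (lpKernel ρ K y * cu (lpKernel ρ N) G (x - y, v)) * ∫ a, lpKernel ρ M (a - y) * F (x - a, v) := by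
    rw [cu]
    congr 1; ext y
    rw [← key]
    ring
  rw [e0, e1]
  refine integral_eq_zero_of_ae ?_
  filter_upwards with a
  rw [Pi.zero_apply]
  refine mul_eq_zero_of_right _ ?_
  obtain ⟨D, hD⟩ := invFourier_bdd (lpSymbol_good hρ M)
  have i2 : Integrable (fun y => lpKernel ρ K y * lpKernel ρ M (a - y)) := by
    refine (lpKernel_int hρ K).mul_bdd (c := D) ?_ ?_
    · have := lpKernel_cont hρ M
      exact Continuous.aestronglyMeasurable (by fun_prop)
    · filter_upwards with y using hD _
  have e2 := swap_int (f := fun a => G (x - a, v)) i2 (lpKernel_int hρ N) (by fun_prop)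
    (fun a => hG.bdd _)
  have e3 : ∫ y, lpKernel ρ K y * cu (lpKernel ρ N) G (x - y, v) * lpKernel ρ M (a - y) =
      ∫ y, lpKernel ρ K y * lpKernel ρ M (a - y) * ∫ b, lpKernel ρ N (b - y) * G (x - b, v) := by
    congr 1; ext y
    rw [← key]
    ring
  rw [e3, e2]
  refine integral_eq_zero_of_ae ?_
  filter_upwards with b
  rw [Pi.zero_apply]
  refine mul_eq_zero_of_right _ ?_
  have := tri_zero (lpSymbol_good hρ K) (lpSymbol_good hρ M) (lpSymbol_good hρ N)
    (compat_of hρ hc) a b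
  simp_rw [mul_assoc]
  exact this

lemma vanish_v {ρ : ℝ → ℝ} (hρ : IsLPCutoff ρ) {K M N : ℕ} (hc : ¬ Compat K M N) {A B : ℝ}
    {F G : ℝ × ℝ → ℝ} (hF : BC A F) (hG : BC B G) :
    cv (lpKernel ρ K) (fun p => cv (lpKernel ρ M) F p * cv (lpKernel ρ N) G p) = fun _ => 0 := by
  ext p
  exact congrFun (vanish_u hρ hc hF.swap hG.swap) p.swap

/-- the partial sums -/
def pv (ρ : ℝ → ℝ) (L : ℕ) (F : ℝ × ℝ → ℝ) (p : ℝ × ℝ) : ℝ :=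
  ∑ k ∈ Finset.range (L + 1), cv (lpKernel ρ k) F p

lemma pv_eq {ρ : ℝ → ℝ} (hρ : IsLPCutoff ρ) (L : ℕ) {A : ℝ} {F : ℝ × ℝ → ℝ} (hF : BC A F) (p : ℝ × ℝ) :
    pv ρ L F p = ∫ z, lpKernel ρ 0 z * F (p.1, p.2 - z / 2 ^ L) := by
  unfold pv cv
  rw [← integral_finsetSum _ (fun k _ => cv_integrable (lpKer hρ k) hF p)]
  simp_rw [← Finset.sum_mul, lpKernel_sum hρ]
  have := Measure.integral_comp_mul_left (fun z => lpKernel ρ 0 z * F (p.1, p.2 - z / 2 ^ L)) ((2:ℝ) ^ L)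
  have hp : (0:ℝ) < 2 ^ L := by positivity
  rw [abs_of_pos (by positivity), smul_eq_mul] at this
  simp_rw [mul_assoc]
  rw [integral_const_mul]
  simp_rw [mul_div_cancel_left₀ _ hp.ne'] at this
  rw [this, mul_inv_cancel_left₀ hp.ne']

lemma pv_bc {ρ : ℝ → ℝ} (hρ : IsLPCutoff ρ) (L : ℕ) {A : ℝ} {F : ℝ × ℝ → ℝ} (hF : BC A F) :
    BC ((∫ y, |lpKernel ρ 0 y|) * A) (pv ρ L F) := by
  refine ⟨(BC.sum _ fun k _ => hF.cv (lpKer hρ k)).cont, fun p => ?_⟩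
  rw [pv_eq hρ L hF]
  have := cu_bdd (F := fun q => F (p.1, p.2 + q.1 / 2 ^ L)) (lpKer hρ 0) (fun q => hF.bdd _) (0, 0)
  refine le_trans (le_of_eq ?_) this
  rw [cu]
  congr 2; ext z
  congr 3
  dsimp only
  ring

lemma pv_tendsto {ρ : ℝ → ℝ} (hρ : IsLPCutoff ρ) {A : ℝ} {F : ℝ × ℝ → ℝ} (hF : BC A F) (p : ℝ × ℝ) :
    Tendsto (fun L => pv ρ L F p) atTop (𝓝 (Real.sqrt (2 * Real.pi) * F p)) := by
  simp_rw [pv_eq hρ _ hF]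
  rw [← lpKernel_zero_integral hρ, ← integral_mul_const]
  have cF := hF.cont
  refine tendsto_integral_of_dominated_convergence (fun y => |lpKernel ρ 0 y| * A) ?_ ?_ ?_ ?_
  · intro n
    have := lpKernel_cont hρ 0
    exact Continuous.aestronglyMeasurable (by fun_prop)
  · exact (lpKernel_int hρ 0).abs.mul_const A
  · intro n
    filter_upwards with y
    rw [Real.norm_eq_abs, abs_mul]
    gcongr
    exact hF.bdd _
  · filter_upwards with z
    refine Tendsto.const_mul _ ?_
    have h1 : Tendsto (fun n : ℕ => z / (2:ℝ) ^ n) atTop (𝓝 0) :=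
      tendsto_const_nhds.div_atTop (tendsto_pow_atTop_atTop_of_one_lt (by norm_num))
    have h2 : Tendsto (fun n : ℕ => (p.1, p.2 - z / (2:ℝ) ^ n)) atTop (𝓝 (p.1, p.2 - 0)) :=
      tendsto_const_nhds.prodMk_nhds (tendsto_const_nhds.sub h1)
    rw [sub_zero] at h2
    exact (cF.tendsto _).comp h2

lemma sum1 {ε : ℝ} (hε : 0 < ε) : ∃ B : ℝ, 0 ≤ B ∧ ∀ (S : Finset ℕ) (a : ℝ),
    ∑ m ∈ S, (2:ℝ) ^ (-ε * |(m:ℝ) - a|) ≤ B := by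
  set r : ℝ := (2:ℝ) ^ (-ε) with hr
  have hr0 : 0 < r := by positivity
  have hr1 : r < 1 := Real.rpow_lt_one_of_one_lt_of_neg (by norm_num) (by linarith)
  have hs : Summable (fun z : ℤ => r ^ z.natAbs) := by
    rw [summable_int_iff_summable_nat_and_neg]
    constructor <;> simpa using summable_geometric_of_lt_one hr0.le hr1
  refine ⟨2 ^ ε * ∑' z : ℤ, r ^ z.natAbs, by positivity, fun S a => ?_⟩
  have h1 : ∀ m : ℕ, (2:ℝ) ^ (-ε * |(m:ℝ) - a|) ≤ 2 ^ ε * r ^ ((m:ℤ) - ⌊a⌋).natAbs := by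
    intro m
    rw [hr, ← Real.rpow_mul_natCast (by norm_num), ← Real.rpow_add (by norm_num)]
    apply Real.rpow_le_rpow_of_exponent_le (by norm_num)
    rw [Nat.cast_natAbs]
    push_cast
    have h2 : |(m:ℝ) - ⌊a⌋| ≤ |(m:ℝ) - a| + 1 := by
      have h3 := abs_sub_le (m:ℝ) a ⌊a⌋
      have h4 : |a - ⌊a⌋| ≤ 1 := by
        rw [abs_le]; constructor <;> linarith [Int.floor_le a, Int.lt_floor_add_one a]
      linarith
    nlinarith
  refine (Finset.sum_le_sum fun m _ => h1 m).trans ?_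
  rw [← Finset.mul_sum]
  gcongr
  let e : ℕ ↪ ℤ := ⟨fun m => (m:ℤ) - ⌊a⌋, fun x y h => by simpa using h⟩
  have := hs.sum_le_tsum (S.map e) (fun i _ => by positivity)
  rwa [Finset.sum_map] at this

lemma sum2 {ε : ℝ} (hε : 0 < ε) : ∃ B : ℝ, 0 ≤ B ∧ ∀ (S : Finset (ℕ × ℕ)) (a : ℝ × ℝ),
    ∑ q ∈ S, (2:ℝ) ^ (-ε * (|(q.1:ℝ) - a.1| + |(q.2:ℝ) - a.2|)) ≤ B := by
  obtain ⟨B, hB, h⟩ := sum1 hε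
  refine ⟨B * B, by positivity, fun S a => ?_⟩
  have hsub : S ⊆ S.image Prod.fst ×ˢ S.image Prod.snd := Finset.subset_product
  refine (Finset.sum_le_sum_of_subset_of_nonneg hsub (fun _ _ _ => by positivity)).trans ?_
  simp_rw [mul_add, Real.rpow_add (show (0:ℝ) < 2 by norm_num)]
  rw [Finset.sum_product]
  dsimp only
  rw [← Finset.sum_mul_sum]
  exact mul_le_mul (h _ _) (h _ _) (by positivity) hB

lemma sum3 {P : ℕ → ℕ × ℕ → Prop} {γ α β ε C : ℝ} (hε : 0 < ε) (c : ℕ → Fin 3 → ℝ × ℝ)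
    (h : ∀ K q, P K q → ∃ i, γ * K - α * q.1 - β * q.2 ≤
      C - ε * (|(q.1:ℝ) - (c K i).1| + |(q.2:ℝ) - (c K i).2|)) :
    ∃ B : ℝ, 0 ≤ B ∧ ∀ (K : ℕ) (S : Finset (ℕ × ℕ)), (∀ q ∈ S, P K q) →
      ∑ q ∈ S, (2:ℝ) ^ (γ * K - α * q.1 - β * q.2) ≤ B := by
  obtain ⟨B, hB, hs⟩ := sum2 hε
  refine ⟨3 * (2 ^ C * B), by positivity, fun K S hS => ?_⟩
  have h1 : ∀ q ∈ S, (2:ℝ) ^ (γ * K - α * q.1 - β * q.2) ≤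
      ∑ i : Fin 3, 2 ^ C * (2:ℝ) ^ (-ε * (|(q.1:ℝ) - (c K i).1| + |(q.2:ℝ) - (c K i).2|)) := by
    intro q hq
    obtain ⟨i, hi⟩ := h K q (hS q hq)
    refine le_trans ?_ (Finset.single_le_sum (f := fun i : Fin 3 => 2 ^ C * (2:ℝ) ^ (-ε * (|(q.1:ℝ) - (c K i).1| + |(q.2:ℝ) - (c K i).2|))) (fun _ _ => by positivity) (Finset.mem_univ i))
    rw [← Real.rpow_add (by norm_num)]
    apply Real.rpow_le_rpow_of_exponent_le (by norm_num)
    linarith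
  refine (Finset.sum_le_sum h1).trans ?_
  rw [Finset.sum_comm]
  calc _ ≤ ∑ i : Fin 3, 2 ^ C * B := by
        refine Finset.sum_le_sum fun i _ => ?_
        rw [← Finset.mul_sum]
        gcongr
        exact hs S (c K i)
    _ = _ := by simp

lemma L1 {ε x t : ℝ} (hx : ε ≤ x) (h0 : 0 < ε) (ht : -2 ≤ t) : -(x * t) ≤ 4 * x - ε * |t| := by
  rcases le_total 0 t with h | h
  · rw [abs_of_nonneg h]; nlinarith
  · rw [abs_of_nonpos h]; nlinarith

lemma L2 {x s : ℝ} (hs : |s| ≤ 2) : x * s ≤ 2 * |x| := by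
  have := le_abs_self (x * s)
  rw [abs_mul] at this
  nlinarith [abs_nonneg x]

lemma caseA_neg {α β γ ε K M N : ℝ} (hγ : γ ≤ α + β) (hε : 0 < ε) (hε1 : ε ≤ 1) (hα : ε ≤ -α)
    (hK : 0 ≤ K) (hN : |N - K| ≤ 2) (hM : M ≤ K + 2) :
    γ * K - α * M - β * N ≤ 10 * (|α| + |β| + 1) - ε * (|M - K| + |N - K|) := by
  have h1 := L1 (t := K - M) hα hε (by linarith)
  have h2 := L2 (x := -β) hN
  rw [abs_sub_comm K M] at h1
  rw [abs_neg] at h2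
  have h3 : (γ - α - β) * K ≤ 0 := mul_nonpos_of_nonpos_of_nonneg (by linarith) hK
  have h4 : -α ≤ |α| := neg_le_abs α
  have h5 : ε * |N - K| ≤ 2 := by nlinarith [abs_nonneg (N - K)]
  nlinarith [abs_nonneg α, abs_nonneg β]

lemma caseB {α β γ ε K M N : ℝ} (hγ : γ ≤ α + β) (hε : 0 < ε) (hε1 : ε ≤ 1) (hα : 2 * ε ≤ α + β)
    (hK : 0 ≤ K) (hN : |M - N| ≤ 2) (hM : K ≤ N + 2) :
    γ * K - α * M - β * N ≤ 10 * (|α| + |β| + 1) - ε * (|M - K| + |N - K|) := by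
  have h1 := L1 (t := N - K) hα (by linarith) (by linarith)
  have h2 := L2 (x := -α) hN
  rw [abs_neg] at h2
  have h3 : (γ - α - β) * K ≤ 0 := mul_nonpos_of_nonpos_of_nonneg (by linarith) hK
  have h4 : α ≤ |α| := le_abs_self α
  have h4' : β ≤ |β| := le_abs_self β
  have h5 : ε * |M - K| ≤ ε * (2 + |N - K|) := by
    have := abs_sub_le M N K
    gcongr
    linarith
  nlinarith [abs_nonneg α, abs_nonneg β]

lemma caseA_pos {α β γ ε K M N : ℝ} (hγ : γ ≤ β) (hε : 0 < ε) (hε1 : ε ≤ 1) (hα : ε ≤ α)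
    (hK : 0 ≤ K) (hN : |N - K| ≤ 2) (hM : 0 ≤ M) :
    γ * K - α * M - β * N ≤ 10 * (|α| + |β| + 1) - ε * (|M - 0| + |N - K|) := by
  have h1 := L1 (t := M) hα (by linarith) (by linarith)
  have h2 := L2 (x := -β) hN
  rw [abs_neg] at h2
  have h3 : (γ - β) * K ≤ 0 := mul_nonpos_of_nonpos_of_nonneg (by linarith) hK
  have h4 : α ≤ |α| := le_abs_self α
  have h5 : ε * |N - K| ≤ 2 := by nlinarith [abs_nonneg (N - K)]
  rw [sub_zero]
  nlinarith [abs_nonneg α, abs_nonneg β]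

lemma caseC {α β γ ε σ K M N : ℝ} (hσ : 0 < σ) (hσ1 : σ < 1) (hγ : γ ≤ α + (1 - σ) * β) (hε : 0 < ε) (hε1 : ε ≤ 1) (hα : ε ≤ β)
    (hK : 0 ≤ K) (hN : |M - K| ≤ 2) (hM : (1 - σ) * M ≤ N) :
    γ * K - α * M - β * N ≤ 10 * (|α| + |β| + 1) - ε * (|M - K| + |N - (1 - σ) * K|) := by
  have h1 := L1 (t := N - (1 - σ) * K) hα (by linarith) (by
    have := (abs_le.1 hN).1
    nlinarith)
  have h2 := L2 (x := -α) hN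
  rw [abs_neg] at h2
  have h3 : (γ - α - (1 - σ) * β) * K ≤ 0 := mul_nonpos_of_nonpos_of_nonneg (by linarith) hK
  have h4 : β ≤ |β| := le_abs_self β
  have h5 : ε * |M - K| ≤ 2 := by nlinarith [abs_nonneg (M - K)]
  nlinarith [abs_nonneg α, abs_nonneg β]

lemma compat_cases {K M N : ℕ} (h : Compat K M N) :
    (|(N:ℝ) - K| ≤ 2 ∧ (M:ℝ) ≤ K + 2) ∨ (|(M:ℝ) - N| ≤ 2 ∧ (K:ℝ) ≤ N + 2) ∨
    (|(M:ℝ) - K| ≤ 2 ∧ (N:ℝ) ≤ K + 2) := by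
  obtain ⟨h1, h2, h3⟩ := h
  have key : (|(N:ℤ) - K| ≤ 2 ∧ (M:ℤ) ≤ K + 2) ∨ (|(M:ℤ) - N| ≤ 2 ∧ (K:ℤ) ≤ N + 2) ∨
    (|(M:ℤ) - K| ≤ 2 ∧ (N:ℤ) ≤ K + 2) := by
    simp only [abs_le]
    omega
  exact_mod_cast key

lemma sum_u {σ α β γ : ℝ} (hσ0 : 0 < σ) (hσ1 : σ < 1) (hα : α < 0) (hβ : 0 < β)
    (hγ : γ ≤ α + (1 - σ) * β) (hab : 0 < α + β) :
    ∃ B : ℝ, 0 ≤ B ∧ ∀ (K : ℕ) (S : Finset (ℕ × ℕ)),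
      (∀ q ∈ S, Compat K q.1 q.2 ∧ (1 - σ) * q.1 ≤ q.2) →
      ∑ q ∈ S, (2:ℝ) ^ (γ * K - α * q.1 - β * q.2) ≤ B := by
  obtain ⟨ε, hε, h1, h2, h3, h4⟩ : ∃ ε : ℝ, 0 < ε ∧ ε ≤ 1 ∧ ε ≤ -α ∧ ε ≤ β ∧ 2 * ε ≤ α + β := by
    refine ⟨min (min 1 (-α)) (min β ((α + β) / 2)), ?_, ?_, ?_, ?_, ?_⟩
    · simp only [lt_min_iff]; refine ⟨⟨?_, ?_⟩, ?_, ?_⟩ <;> linarith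
    · exact (min_le_left _ _).trans (min_le_left _ _)
    · exact (min_le_left _ _).trans (min_le_right _ _)
    · exact (min_le_right _ _).trans (min_le_left _ _)
    · have := (min_le_right (min 1 (-α)) (min β ((α + β) / 2))).trans (min_le_right _ _)
      linarith
  have hγ' : γ ≤ α + β := by nlinarith
  refine sum3 (P := fun K q => Compat K q.1 q.2 ∧ (1 - σ) * q.1 ≤ q.2) (C := 10 * (|α| + |β| + 1)) hε
    (fun K => ![((K:ℝ), (K:ℝ)), ((K:ℝ), (1 - σ) * K), ((K:ℝ), (K:ℝ))]) ?_
  rintro K ⟨M, N⟩ ⟨hc, hl⟩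
  have hK : (0:ℝ) ≤ K := Nat.cast_nonneg _
  rcases compat_cases hc with ⟨a, b⟩ | ⟨a, b⟩ | ⟨a, b⟩
  · exact ⟨0, caseA_neg hγ' hε h1 h2 hK a b⟩
  · exact ⟨0, caseB hγ' hε h1 h4 hK a b⟩
  · exact ⟨1, caseC hσ0 hσ1 hγ hε h1 h3 hK a hl⟩

lemma sum_v {α β γ : ℝ} (hα : α ≠ 0) (hβ : β ≠ 0)
    (hγ : γ ≤ min α β) (hab : 0 < α + β) :
    ∃ B : ℝ, 0 ≤ B ∧ ∀ (K : ℕ) (S : Finset (ℕ × ℕ)),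
      (∀ q ∈ S, Compat K q.1 q.2) →
      ∑ q ∈ S, (2:ℝ) ^ (γ * K - α * q.1 - β * q.2) ≤ B := by
  obtain ⟨ε, hε, h1, h2, h3, h4⟩ : ∃ ε : ℝ, 0 < ε ∧ ε ≤ 1 ∧ ε ≤ |α| ∧ ε ≤ |β| ∧ 2 * ε ≤ α + β := by
    refine ⟨min (min 1 (|α|)) (min (|β|) ((α + β) / 2)), ?_, ?_, ?_, ?_, ?_⟩
    · simp only [lt_min_iff]; refine ⟨⟨?_, ?_⟩, ?_, ?_⟩ <;> first | positivity | linarith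
    · exact (min_le_left _ _).trans (min_le_left _ _)
    · exact (min_le_left _ _).trans (min_le_right _ _)
    · exact (min_le_right _ _).trans (min_le_left _ _)
    · have := (min_le_right (min 1 (|α|)) (min (|β|) ((α + β) / 2))).trans (min_le_right _ _)
      linarith
  have ha : γ ≤ α := hγ.trans (min_le_left _ _)
  have hb : γ ≤ β := hγ.trans (min_le_right _ _)
  have hγ' : γ ≤ α + β := by
    rcases le_total 0 α with h | h <;> linarith
  refine sum3 (P := fun K q => Compat K q.1 q.2) (C := 10 * (|α| + |β| + 1)) hε
    (fun K => ![((K:ℝ), (K:ℝ)), (0, (K:ℝ)), ((K:ℝ), 0)]) ?_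
  rintro K ⟨M, N⟩ hc
  have hK : (0:ℝ) ≤ K := Nat.cast_nonneg _
  have hM : (0:ℝ) ≤ M := Nat.cast_nonneg _
  have hN : (0:ℝ) ≤ N := Nat.cast_nonneg _
  rcases compat_cases hc with ⟨a, b⟩ | ⟨a, b⟩ | ⟨a, b⟩
  · rcases lt_or_gt_of_ne hα with h | h
    · rw [abs_of_neg h] at h2
      exact ⟨0, caseA_neg hγ' hε h1 h2 hK a b⟩
    · rw [abs_of_pos h] at h2
      exact ⟨1, caseA_pos hb hε h1 h2 hK a hM⟩
  · exact ⟨0, caseB hγ' hε h1 h4 hK a b⟩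
  · rcases lt_or_gt_of_ne hβ with h | h
    · rw [abs_of_neg h] at h3
      have := caseA_neg (γ := γ) (α := β) (β := α) (M := N) (N := M) (by linarith) hε h1 h3 hK a b
      refine ⟨0, ?_⟩
      simp
      linarith
    · rw [abs_of_pos h] at h3
      have := caseA_pos (α := β) (β := α) (M := N) (N := M) ha hε h1 h3 hK a hN
      refine ⟨2, ?_⟩
      simp at this ⊢
      linarith

lemma cu_const_mul (φ : ℝ → ℝ) (c : ℝ) (F : ℝ × ℝ → ℝ) :
    cu φ (fun p => c * F p) = fun p => c * cu φ F p := by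
  ext p
  unfold cu
  rw [← integral_const_mul]
  congr 1; ext y; ring

lemma cv_const_mul (φ : ℝ → ℝ) (c : ℝ) (F : ℝ × ℝ → ℝ) :
    cv φ (fun p => c * F p) = fun p => c * cv φ F p := by
  ext p
  unfold cv
  rw [← integral_const_mul]
  congr 1; ext y; ring

lemma piece_bound {ρ : ℝ → ℝ} {γ₁ γ₂ : ℝ} {F : ℝ × ℝ → ℝ} (h : hNorm2 ρ γ₁ γ₂ F ≠ ∞)
    (k₁ k₂ : ℕ) (p : ℝ × ℝ) :
    |cu (lpKernel ρ k₁) (cv (lpKernel ρ k₂) F) p| ≤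
      (hNorm2 ρ γ₁ γ₂ F).toReal * (2:ℝ) ^ (-(γ₁ * k₁ + γ₂ * k₂)) := by
  have h1 : ENNReal.ofReal (((2 : ℝ) ^ k₁) ^ γ₁ * ((2 : ℝ) ^ k₂) ^ γ₂) *
      ENNReal.ofReal |LPu ρ k₁ (LPv ρ k₂ F) p| ≤ hNorm2 ρ γ₁ γ₂ F := by
    unfold hNorm2
    refine le_trans ?_ (le_iSup₂ k₁ k₂)
    gcongr
    exact le_iSup (fun p => ENNReal.ofReal |LPu ρ k₁ (LPv ρ k₂ F) p|) p
  rw [← ENNReal.ofReal_mul (by positivity)] at h1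
  have h2 := (ENNReal.ofReal_le_iff_le_toReal h).1 h1
  have e : ((2 : ℝ) ^ k₁) ^ γ₁ * ((2 : ℝ) ^ k₂) ^ γ₂ = (2:ℝ) ^ (γ₁ * k₁ + γ₂ * k₂) := by
    rw [Real.rpow_add (by norm_num), mul_comm γ₁, mul_comm γ₂, Real.rpow_natCast_mul (by norm_num),
      Real.rpow_natCast_mul (by norm_num)]
  rw [e] at h2
  rw [Real.rpow_neg (by norm_num), ← div_eq_mul_inv, le_div_iff₀ (by positivity), mul_comm]
  exact h2

lemma cu_eq_zero {ρ : ℝ → ℝ} (hρ : IsLPCutoff ρ) {γ₁ γ₂ A : ℝ} {F : ℝ × ℝ → ℝ} (hF : BC A F)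
    (h : hNorm2 ρ γ₁ γ₂ F = 0) (k : ℕ) (p : ℝ × ℝ) : cu (lpKernel ρ k) F p = 0 := by
  have h1 := pv_tendsto hρ (hF.cu (lpKer hρ k)) p
  have h2 : ∀ L, pv ρ L (cu (lpKernel ρ k) F) p = 0 := by
    intro L
    refine Finset.sum_eq_zero fun j _ => ?_
    rw [← cu_cv_comm (lpKer hρ k) (lpKer hρ j) hF]
    have := piece_bound (by rw [h]; simp) k j p (γ₁ := γ₁) (γ₂ := γ₂) (ρ := ρ) (F := F)
    rw [h] at this
    simpa using this
  simp_rw [h2] at h1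
  have h3 := tendsto_nhds_unique h1 tendsto_const_nhds
  have : 0 < √(2 * π) := by positivity
  rcases mul_eq_zero.1 h3 with h4 | h4
  · linarith
  · exact h4

lemma term_bound {ρ : ℝ → ℝ} (hρ : IsLPCutoff ρ) {C₀ : ℝ} (hC₀ : 0 < C₀)
    (hL1 : ∀ k, ∫ x, |lpKernel ρ k x| ≤ C₀) {f g : ℝ × ℝ → ℝ} {a b : ℝ} (ha : 0 ≤ a) (hb : 0 ≤ b)
    (hf : ∀ p, |f p| ≤ a) (hg : ∀ p, |g p| ≤ b) (K₁ K₂ : ℕ) (p : ℝ × ℝ) :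
    |cu (lpKernel ρ K₁) (cv (lpKernel ρ K₂) (fun p => f p * g p)) p| ≤ C₀ * (C₀ * (a * b)) := by
  have h1 : ∀ p, |f p * g p| ≤ a * b := fun p => by
    rw [abs_mul]; exact mul_le_mul (hf p) (hg p) (abs_nonneg _) ha
  have h2 : ∀ p, |cv (lpKernel ρ K₂) (fun p => f p * g p) p| ≤ C₀ * (a * b) := fun p =>
    (cv_bdd (lpKer hρ K₂) h1 p).trans (by gcongr; exact hL1 _)
  exact (cu_bdd (lpKer hρ K₁) h2 p).trans (by gcongr; exact hL1 _)

lemma term_zero {ρ : ℝ → ℝ} (hρ : IsLPCutoff ρ) {A B : ℝ} {F G : ℝ × ℝ → ℝ} (hF : BC A F) (hG : BC B G)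
    {K₁ K₂ M N m n : ℕ} (h : ¬ (Compat K₁ M N ∧ Compat K₂ m n)) (p : ℝ × ℝ) :
    cu (lpKernel ρ K₁) (cv (lpKernel ρ K₂) (fun p => cu (lpKernel ρ M) (cv (lpKernel ρ m) F) p *
      cu (lpKernel ρ N) (cv (lpKernel ρ n) G) p)) p = 0 := by
  by_cases h1 : Compat K₁ M N
  · have h2 : ¬ Compat K₂ m n := fun h2 => h ⟨h1, h2⟩
    rw [cu_cv_comm (lpKer hρ M) (lpKer hρ m) hF, cu_cv_comm (lpKer hρ N) (lpKer hρ n) hG,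
      vanish_v hρ h2 (hF.cu (lpKer hρ M)) (hG.cu (lpKer hρ N)), cu_zero]
  · rw [cu_cv_comm (lpKer hρ K₁) (lpKer hρ K₂)
      (((hF.cv (lpKer hρ m)).cu (lpKer hρ M)).mul ((hG.cv (lpKer hρ n)).cu (lpKer hρ N))),
      vanish_u hρ h1 (hF.cv (lpKer hρ m)) (hG.cv (lpKer hρ n)), cv_zero]

lemma finite_bound {ρ : ℝ → ℝ} (hρ : IsLPCutoff ρ) {C₀ : ℝ} (hC₀ : 0 < C₀)
    (hL1 : ∀ k, ∫ x, |lpKernel ρ k x| ≤ C₀) {α₁ α₂ β₁ β₂ γ₁ γ₂ Bu Bv A B a b : ℝ} {F G : ℝ × ℝ → ℝ}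
    (hF : BC a F) (hG : BC b G) (hA : 0 ≤ A) (hB : 0 ≤ B) (hBu : 0 ≤ Bu)
    (hFA : ∀ (M m : ℕ) (p : ℝ × ℝ), |cu (lpKernel ρ M) (cv (lpKernel ρ m) F) p| ≤ A * (2:ℝ) ^ (-(α₁ * M + α₂ * m)))
    (hGB : ∀ (M m : ℕ) (p : ℝ × ℝ), |cu (lpKernel ρ M) (cv (lpKernel ρ m) G) p| ≤ B * (2:ℝ) ^ (-(β₁ * M + β₂ * m)))
    (S : Finset (ℕ × ℕ)) (K₁ K₂ : ℕ)
    (hSu : ∑ q ∈ S with Compat K₁ q.1 q.2, (2:ℝ) ^ (γ₁ * K₁ - α₁ * q.1 - β₁ * q.2) ≤ Bu)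
    (hSv : ∀ T : Finset (ℕ × ℕ), ∑ q ∈ T with Compat K₂ q.1 q.2, (2:ℝ) ^ (γ₂ * K₂ - α₂ * q.1 - β₂ * q.2) ≤ Bv)
    (L : ℕ) (p : ℝ × ℝ) :
    (2:ℝ) ^ (γ₁ * K₁ + γ₂ * K₂) * |cu (lpKernel ρ K₁) (cv (lpKernel ρ K₂)
      (fun p => ∑ q ∈ S, cu (lpKernel ρ q.1) (pv ρ L F) p * cu (lpKernel ρ q.2) (pv ρ L G) p)) p|
      ≤ C₀ * C₀ * (Bu * Bv) * A * B := by
  set R := Finset.range (L + 1)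
  let f : ℕ → ℕ → ℝ × ℝ → ℝ := fun M m => cu (lpKernel ρ M) (cv (lpKernel ρ m) F)
  let g : ℕ → ℕ → ℝ × ℝ → ℝ := fun M m => cu (lpKernel ρ M) (cv (lpKernel ρ m) G)
  have eF : ∀ M, cu (lpKernel ρ M) (pv ρ L F) = fun p => ∑ m ∈ R, f M m p := fun M =>
    cu_sum (lpKer hρ M) R (fun m _ => hF.cv (lpKer hρ m))
  have eG : ∀ M, cu (lpKernel ρ M) (pv ρ L G) = fun p => ∑ m ∈ R, g M m p := fun M =>
    cu_sum (lpKer hρ M) R (fun m _ => hG.cv (lpKer hρ m))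
  have bterm : ∀ x : (ℕ × ℕ) × (ℕ × ℕ), BC _ (fun p => f x.1.1 x.2.1 p * g x.1.2 x.2.2 p) := fun x =>
    ((hF.cv (lpKer hρ x.2.1)).cu (lpKer hρ x.1.1)).mul ((hG.cv (lpKer hρ x.2.2)).cu (lpKer hρ x.1.2))
  have e1 : (fun p => ∑ q ∈ S, cu (lpKernel ρ q.1) (pv ρ L F) p * cu (lpKernel ρ q.2) (pv ρ L G) p)
      = fun p => ∑ x ∈ S ×ˢ (R ×ˢ R), f x.1.1 x.2.1 p * g x.1.2 x.2.2 p := by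
    ext p
    rw [Finset.sum_product]
    refine Finset.sum_congr rfl fun q _ => ?_
    rw [eF, eG]
    dsimp only
    rw [Finset.sum_mul_sum, Finset.sum_product]
  rw [e1, cv_sum (lpKer hρ K₂) _ (fun x _ => bterm x),
    cu_sum (lpKer hρ K₁) _ (fun x _ => (bterm x).cv (lpKer hρ K₂))]
  dsimp only
  have e2 : ∀ x ∈ S ×ˢ (R ×ˢ R), (2:ℝ) ^ (γ₁ * K₁ + γ₂ * K₂) *
      |cu (lpKernel ρ K₁) (cv (lpKernel ρ K₂) (fun p => f x.1.1 x.2.1 p * g x.1.2 x.2.2 p)) p| ≤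
      C₀ * C₀ * A * B * ((if Compat K₁ x.1.1 x.1.2 then (2:ℝ) ^ (γ₁ * K₁ - α₁ * x.1.1 - β₁ * x.1.2) else 0) *
        (if Compat K₂ x.2.1 x.2.2 then (2:ℝ) ^ (γ₂ * K₂ - α₂ * x.2.1 - β₂ * x.2.2) else 0)) := by
    intro x _
    by_cases h : Compat K₁ x.1.1 x.1.2 ∧ Compat K₂ x.2.1 x.2.2
    · rw [if_pos h.1, if_pos h.2]
      have := term_bound hρ hC₀ hL1 (f := f x.1.1 x.2.1) (g := g x.1.2 x.2.2) (by positivity) (by positivity)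
        (hFA x.1.1 x.2.1) (hGB x.1.2 x.2.2) K₁ K₂ p
      refine (mul_le_mul_of_nonneg_left this (by positivity)).trans (le_of_eq ?_)
      have e3 : (2:ℝ) ^ (γ₁ * K₁ - α₁ * x.1.1 - β₁ * x.1.2) * (2:ℝ) ^ (γ₂ * K₂ - α₂ * x.2.1 - β₂ * x.2.2)
        = (2:ℝ) ^ (γ₁ * K₁ + γ₂ * K₂) * ((2:ℝ) ^ (-(α₁ * x.1.1 + α₂ * x.2.1)) * (2:ℝ) ^ (-(β₁ * x.1.2 + β₂ * x.2.2))) := by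
        rw [← Real.rpow_add (by norm_num), ← Real.rpow_add (by norm_num), ← Real.rpow_add (by norm_num)]
        congr 1; ring
      rw [e3]; ring
    · rw [term_zero hρ hF hG h p]
      simp only [abs_zero, mul_zero]
      positivity
  calc _ ≤ (2:ℝ) ^ (γ₁ * K₁ + γ₂ * K₂) * ∑ x ∈ S ×ˢ (R ×ˢ R),
        |cu (lpKernel ρ K₁) (cv (lpKernel ρ K₂) (fun p => f x.1.1 x.2.1 p * g x.1.2 x.2.2 p)) p| := by
        gcongr
        exact Finset.abs_sum_le_sum_abs _ _
    _ ≤ C₀ * C₀ * A * B * ((∑ q ∈ S with Compat K₁ q.1 q.2, (2:ℝ) ^ (γ₁ * K₁ - α₁ * q.1 - β₁ * q.2)) *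
         (∑ q ∈ R ×ˢ R with Compat K₂ q.1 q.2, (2:ℝ) ^ (γ₂ * K₂ - α₂ * q.1 - β₂ * q.2))) := by
        rw [Finset.mul_sum]
        refine (Finset.sum_le_sum e2).trans (le_of_eq ?_)
        rw [← Finset.mul_sum, Finset.sum_filter, Finset.sum_filter, Finset.sum_mul_sum, Finset.sum_product]
    _ ≤ C₀ * C₀ * A * B * (Bu * Bv) := by
        gcongr
        exact hSv _
    _ = _ := by ring

lemma main_bound {ρ : ℝ → ℝ} (hρ : IsLPCutoff ρ) {a b X w : ℝ} {F G : ℝ × ℝ → ℝ}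
    (hF : BC a F) (hG : BC b G) (S : Finset (ℕ × ℕ)) (K₁ K₂ : ℕ) (p : ℝ × ℝ) (hw : 0 ≤ w)
    (h : ∀ L, w * |cu (lpKernel ρ K₁) (cv (lpKernel ρ K₂)
      (fun p => ∑ q ∈ S, cu (lpKernel ρ q.1) (pv ρ L F) p * cu (lpKernel ρ q.2) (pv ρ L G) p)) p| ≤ X) :
    w * |cu (lpKernel ρ K₁) (cv (lpKernel ρ K₂)
      (fun p => ∑ q ∈ S, cu (lpKernel ρ q.1) F p * cu (lpKernel ρ q.2) G p)) p| ≤ X := by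
  have t1 : ∀ {c : ℝ} {H : ℝ × ℝ → ℝ}, BC c H → ∀ (k : ℕ) (p : ℝ × ℝ),
      Tendsto (fun L => cu (lpKernel ρ k) (pv ρ L H) p) atTop (𝓝 (√(2 * π) * cu (lpKernel ρ k) H p)) := by
    intro c H hH k p
    have := cu_tendsto (lpKer hρ k) (fun L => pv_bc hρ L hH) (fun p => pv_tendsto hρ hH p) p
    rwa [cu_const_mul] at this
  have t2 : ∀ p, Tendsto (fun L => ∑ q ∈ S, cu (lpKernel ρ q.1) (pv ρ L F) p * cu (lpKernel ρ q.2) (pv ρ L G) p)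
      atTop (𝓝 ((2 * π) * ∑ q ∈ S, cu (lpKernel ρ q.1) F p * cu (lpKernel ρ q.2) G p)) := by
    intro p
    rw [Finset.mul_sum]
    refine tendsto_finsetSum _ fun q _ => ?_
    have := (t1 hF q.1 p).mul (t1 hG q.2 p)
    convert this using 2
    have hs : √(2 * π) * √(2 * π) = 2 * π := Real.mul_self_sqrt (by positivity)
    linear_combination (-(cu (lpKernel ρ q.1) F p * cu (lpKernel ρ q.2) G p)) * hs
  have b1 := fun L => BC.sum S (fun q _ =>
    ((pv_bc hρ L hF).cu (lpKer hρ q.1)).mul ((pv_bc hρ L hG).cu (lpKer hρ q.2)))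
  have t3 := cu_tendsto (lpKer hρ K₁) (fun L => (b1 L).cv (lpKer hρ K₂))
    (fun p => cv_tendsto (lpKer hρ K₂) b1 t2 p) p
  rw [cv_const_mul, cu_const_mul] at t3
  have t4 := le_of_tendsto (t3.abs.const_mul w) (Eventually.of_forall h)
  refine le_trans (mul_le_mul_of_nonneg_left ?_ hw) t4
  dsimp only
  rw [abs_mul, abs_of_pos (by positivity : 0 < 2 * π)]
  have : (1:ℝ) ≤ 2 * π := by linarith [Real.pi_gt_three]
  exact le_mul_of_one_le_left (abs_nonneg _) this

lemma CbSmooth.bc {F : ℝ × ℝ → ℝ} (h : CbSmooth F) : ∃ C, BC C F := by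
  obtain ⟨C, hC⟩ := h.2 0
  refine ⟨C, h.1.continuous, fun p => ?_⟩
  have := hC p
  rwa [norm_iteratedFDeriv_zero] at this

lemma hNorm2_zero (ρ : ℝ → ℝ) (γ₁ γ₂ : ℝ) : hNorm2 ρ γ₁ γ₂ (fun _ => 0) = 0 := by
  unfold hNorm2
  simp [LPu, LPv]


/-- **Proposition 2.6(ii): low×high improvement of the bilinear paraproduct estimate.**
For `σ ∈ (0,1)`, `α₁ < 0 < β₁`, `γ₁ ≤ α₁ + (1−σ)β₁`, `α₁ + β₁ > 0`, and standard conditions in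
the second variable, the paraproduct `Σ_{(M,N)∈S, M ≤ N^{1/(1−σ)}} P_M^u F · P_N^u G` obeys the
bilinear estimate. -/
theorem bilinear_paraproduct_lowhigh
    (ρ : ℝ → ℝ) (hρ : IsLPCutoff ρ)
    (σ : ℝ) (hσ0 : 0 < σ) (hσ1 : σ < 1)
    (α₁ α₂ β₁ β₂ γ₁ γ₂ : ℝ)
    (hα₁ : α₁ < 0) (hβ₁ : 0 < β₁)
    (hγ₁ : γ₁ ≤ α₁ + (1 - σ) * β₁) (hab₁ : 0 < α₁ + β₁)
    (hα₂ : α₂ ≠ 0) (hβ₂ : β₂ ≠ 0) (hγ₂ : γ₂ ≤ min α₂ β₂) (hab₂ : 0 < α₂ + β₂) :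
    ∃ C : ℝ≥0∞, C ≠ ∞ ∧ ∀ F G : ℝ × ℝ → ℝ, CbSmooth F → CbSmooth G →
      ∀ S : Finset (ℕ × ℕ),
        (∀ q ∈ S, (2 : ℝ) ^ q.1 ≤ ((2 : ℝ) ^ q.2) ^ ((1 : ℝ) / (1 - σ))) →
        hNorm2 ρ γ₁ γ₂ (fun p => ∑ q ∈ S, LPu ρ q.1 F p * LPu ρ q.2 G p) ≤
          C * hNorm2 ρ α₁ α₂ F * hNorm2 ρ β₁ β₂ G := by
  obtain ⟨C₀, hC₀, hL1⟩ := lpKernel_L1 hρ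
  obtain ⟨Bu, hBu, hsu⟩ := sum_u hσ0 hσ1 hα₁ hβ₁ hγ₁ hab₁
  obtain ⟨Bv, hBv, hsv⟩ := sum_v hα₂ hβ₂ hγ₂ hab₂
  set D : ℝ := C₀ * C₀ * (Bu * Bv) + 1 with hD
  have hDpos : 0 < D := by positivity
  refine ⟨ENNReal.ofReal D, ENNReal.ofReal_ne_top, fun F G hF hG S hS => ?_⟩
  obtain ⟨a, hF⟩ := hF.bc
  obtain ⟨b, hG⟩ := hG.bc
  have hD0 : ENNReal.ofReal D ≠ 0 := by simpa using hDpos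
  by_cases hF0 : hNorm2 ρ α₁ α₂ F = 0
  · have : (fun p => ∑ q ∈ S, LPu ρ q.1 F p * LPu ρ q.2 G p) = fun _ => 0 := by
      ext p
      refine Finset.sum_eq_zero fun q _ => ?_
      rw [LPu_eq, cu_eq_zero hρ hF hF0, zero_mul]
    rw [this, hNorm2_zero]
    exact zero_le
  by_cases hG0 : hNorm2 ρ β₁ β₂ G = 0
  · have : (fun p => ∑ q ∈ S, LPu ρ q.1 F p * LPu ρ q.2 G p) = fun _ => 0 := by
      ext p
      refine Finset.sum_eq_zero fun q _ => ?_
      rw [LPu_eq ρ q.2, cu_eq_zero hρ hG hG0, mul_zero]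
    rw [this, hNorm2_zero]
    exact zero_le
  by_cases hFt : hNorm2 ρ α₁ α₂ F = ∞
  · rw [hFt, ENNReal.mul_top hD0, ENNReal.top_mul hG0]
    exact le_top
  by_cases hGt : hNorm2 ρ β₁ β₂ G = ∞
  · rw [hGt, ENNReal.mul_top (mul_ne_zero hD0 hF0)]
    exact le_top
  have hS' : ∀ q ∈ S, (1 - σ) * (q.1 : ℝ) ≤ q.2 := by
    intro q hq
    have h1 := hS q hq
    have hs : 0 < 1 - σ := by linarith
    rw [← Real.rpow_natCast_mul (by norm_num), ← Real.rpow_natCast,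
      Real.rpow_le_rpow_left_iff (by norm_num), mul_one_div, le_div_iff₀ hs] at h1
    linarith
  set A := hNorm2 ρ α₁ α₂ F
  set B := hNorm2 ρ β₁ β₂ G
  have hR : ENNReal.ofReal D * A * B = ENNReal.ofReal (D * A.toReal * B.toReal) := by
    rw [ENNReal.ofReal_mul (by positivity), ENNReal.ofReal_mul hDpos.le, ENNReal.ofReal_toReal hFt,
      ENNReal.ofReal_toReal hGt]
  rw [hR]
  unfold hNorm2
  refine iSup₂_le fun K₁ K₂ => ?_
  rw [ENNReal.mul_iSup]
  refine iSup_le fun p => ?_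
  rw [← ENNReal.ofReal_mul (by positivity)]
  apply ENNReal.ofReal_le_ofReal
  have e : ((2 : ℝ) ^ K₁) ^ γ₁ * ((2 : ℝ) ^ K₂) ^ γ₂ = (2:ℝ) ^ (γ₁ * K₁ + γ₂ * K₂) := by
    rw [Real.rpow_add (by norm_num), mul_comm γ₁, mul_comm γ₂, Real.rpow_natCast_mul (by norm_num),
      Real.rpow_natCast_mul (by norm_num)]
  rw [e]
  have key := main_bound hρ hF hG S K₁ K₂ p (w := (2:ℝ) ^ (γ₁ * K₁ + γ₂ * K₂)) (by positivity)
    (fun L => finite_bound hρ hC₀ hL1 (γ₁ := γ₁) (γ₂ := γ₂) hF hG ENNReal.toReal_nonneg ENNReal.toReal_nonneg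
      hBu (piece_bound hFt) (piece_bound hGt) S K₁ K₂
      (hsu K₁ _ (fun q hq => by
        rw [Finset.mem_filter] at hq
        exact ⟨hq.2, hS' q hq.1⟩))
      (fun T => hsv K₂ _ (fun q hq => (Finset.mem_filter.1 hq).2)) L p)
  refine le_trans key ?_
  gcongr
  linarith
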